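/- Strong duality holds for the information-energy capacity problem: if there exists a Slater point x₁ ∈ [0, A] with x₁² < P and ℰ(x₁) > E_req, then there exist constants λ₁ ≥ 0 and λ₂ ≥ 0 such that C = sup over all Borel probability measures F on [0, A] of I(F) − λ₁·(∫₀^A x² dF(x) − P) − λ₂·(E_req − ∫₀^A ℰ(x) dF(x)). -/

import Mathlib

open MeasureTheory Real Set Filter

/-- Phase-removed Rayleigh-fading channel density `p(y|x)`. -/
noncomputable def pcond (x y : ℝ) : ℝ := (1 / (1 + x ^ 2)) * Real.exp (-y / (1 + x ^ 2))

/-- Modified Bessel function of the first kind, order zero. -/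
noncomputable def besselI0 (t : ℝ) : ℝ := ∑' n : ℕ, (t ^ 2 / 4) ^ n / ((Nat.factorial n : ℝ)) ^ 2

/-- Harvested-energy function `ℰ(x) = I₀(√2 B h₂ x)`. -/
noncomputable def EH (B h2 x : ℝ) : ℝ := besselI0 (Real.sqrt 2 * B * h2 * x)

/-- Output density `p(y; F)`. -/
noncomputable def pout (F : Measure ℝ) (y : ℝ) : ℝ := ∫ x, pcond x y ∂F

/-- Mutual-information density `i(x; F)`. -/
noncomputable def idens (F : Measure ℝ) (x : ℝ) : ℝ :=
  ∫ y in Set.Ioi (0 : ℝ), pcond x y * Real.log (pcond x y / pout F y)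

/-- Mutual information `I(F)`. -/
noncomputable def MI (F : Measure ℝ) : ℝ := ∫ x, idens F x ∂F

/-- Borel probability measure concentrated on `[0, A]`. -/
def IsDistOn (A : ℝ) (F : Measure ℝ) : Prop :=
  IsProbabilityMeasure F ∧ F (Set.Icc 0 A)ᶜ = 0

/-- The feasible set `Ω`: probability measures on `[0,A]` meeting the AP and EH constraints. -/
def Feas (A P B h2 Ereq : ℝ) (F : Measure ℝ) : Prop :=
  IsDistOn A F ∧ (∫ x, x ^ 2 ∂F) ≤ P ∧ Ereq ≤ ∫ x, EH B h2 x ∂F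

/-- Information-energy capacity `C = sup_{F ∈ Ω} I(F)`. -/
noncomputable def Cap (A P B h2 Ereq : ℝ) : ℝ :=
  sSup (MI '' {F | Feas A P B h2 Ereq F})

/-- Topological support of a measure: points all of whose open neighborhoods have
positive measure (the smallest closed set of full measure). -/
def msupp {X : Type*} [TopologicalSpace X] [MeasurableSpace X] (μ : Measure X) : Set X :=
  {x | ∀ U : Set X, IsOpen U → x ∈ U → 0 < μ U}

/-- Lagrange multipliers for the concave maximization of `J` under two convex constraints
`g₁ ≤ 0`, `g₂ ≤ 0`, where the mixtures of points of `S` need only satisfy the concavity and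
convexity inequalities. -/
lemma exists_lagrange_multipliers {α : Type*} {S : Set α} {J g₁ g₂ : α → ℝ} {C : ℝ}
    (hmix : ∀ F₁ ∈ S, ∀ F₂ ∈ S, ∀ a b : ℝ, 0 < a → 0 < b → a + b = 1 → ∃ G ∈ S,
      g₁ G ≤ a * g₁ F₁ + b * g₁ F₂ ∧ g₂ G ≤ a * g₂ F₁ + b * g₂ F₂ ∧
        a * J F₁ + b * J F₂ ≤ J G)
    {F₀ : α} (hF₀ : F₀ ∈ S) (h₁ : g₁ F₀ < 0) (h₂ : g₂ F₀ < 0)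
    (hC : ∀ F ∈ S, g₁ F ≤ 0 → g₂ F ≤ 0 → J F ≤ C) :
    ∃ l₁ l₂ : ℝ, 0 ≤ l₁ ∧ 0 ≤ l₂ ∧ ∀ F ∈ S, J F - l₁ * g₁ F - l₂ * g₂ F ≤ C := by
  set T : Set (ℝ × ℝ × ℝ) := ⋃ F ∈ S, Ioi (g₁ F) ×ˢ Ioi (g₂ F) ×ˢ Iio (J F) with hT
  have memT : ∀ u v w : ℝ, (u, v, w) ∈ T ↔ ∃ F ∈ S, g₁ F < u ∧ g₂ F < v ∧ w < J F := by
    intro u v w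
    simp only [hT, mem_iUnion, mem_prod, mem_Ioi, mem_Iio, exists_prop]
  have hTo : IsOpen T :=
    isOpen_biUnion fun F _ => isOpen_Ioi.prod (isOpen_Ioi.prod isOpen_Iio)
  have hTc : Convex ℝ T := by
    rw [convex_iff_forall_pos]
    rintro ⟨u, v, w⟩ hx ⟨u', v', w'⟩ hy a b ha hb hab
    obtain ⟨F₁, hF₁, p₁, p₂, p₃⟩ := (memT _ _ _).1 hx
    obtain ⟨F₂, hF₂, q₁, q₂, q₃⟩ := (memT _ _ _).1 hy
    obtain ⟨G, hG, r₁, r₂, r₃⟩ := hmix F₁ hF₁ F₂ hF₂ a b ha hb hab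
    refine (memT (a * u + b * u') (a * v + b * v') (a * w + b * w')).2 ⟨G, hG, ?_, ?_, ?_⟩
    · have := mul_lt_mul_of_pos_left p₁ ha
      have := mul_lt_mul_of_pos_left q₁ hb
      linarith
    · have := mul_lt_mul_of_pos_left p₂ ha
      have := mul_lt_mul_of_pos_left q₂ hb
      linarith
    · have := mul_lt_mul_of_pos_left p₃ ha
      have := mul_lt_mul_of_pos_left q₃ hb
      linarith
  have hCT : ((0 : ℝ), (0 : ℝ), C) ∉ T := by
    rw [memT]
    rintro ⟨F, hF, p₁, p₂, p₃⟩
    exact absurd (hC F hF p₁.le p₂.le) (not_le.2 p₃)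
  obtain ⟨f, hf⟩ := geometric_hahn_banach_open_point hTc hTo hCT
  set α' := f (1, 0, 0)
  set β := f (0, 1, 0)
  set γ := f (0, 0, 1)
  have hfe : ∀ u v w : ℝ, f (u, v, w) = u * α' + v * β + w * γ := by
    intro u v w
    have : ((u, v, w) : ℝ × ℝ × ℝ) = u • (1, 0, 0) + v • (0, 1, 0) + w • (0, 0, 1) := by
      simp
    rw [this, map_add, map_add, map_smul, map_smul, map_smul]
    simp [α', β, γ]
  have key : ∀ F ∈ S, ∀ u v w : ℝ, g₁ F < u → g₂ F < v → w < J F →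
      u * α' + v * β + w * γ < C * γ := by
    intro F hF u v w hu hv hw
    have := hf _ ((memT u v w).2 ⟨F, hF, hu, hv, hw⟩)
    rw [hfe, hfe] at this
    linarith
  have lim : ∀ c d : ℝ, (∀ t : ℝ, 0 ≤ t → t * c < d) → c ≤ 0 := by
    intro c d h
    by_contra! hc
    have h1 := h (|d| / c) (by positivity)
    rw [div_mul_cancel₀ _ hc.ne'] at h1
    exact absurd (le_abs_self d) (not_le.2 h1)
  have hα : α' ≤ 0 := by
    refine lim _ (C * γ - (J F₀ - 1) * γ) fun t ht => ?_
    have := key F₀ hF₀ t 0 (J F₀ - 1) (by linarith) h₂ (by linarith)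
    linarith
  have hβ : β ≤ 0 := by
    refine lim _ (C * γ - (J F₀ - 1) * γ) fun t ht => ?_
    have := key F₀ hF₀ 0 t (J F₀ - 1) h₁ (by linarith) (by linarith)
    linarith
  have hγ0 : -γ ≤ 0 := by
    refine lim _ (C * γ - (J F₀ - 1) * γ) fun t ht => ?_
    have := key F₀ hF₀ 0 0 (J F₀ - 1 - t) h₁ h₂ (by linarith)
    linarith
  have hγ : 0 < γ := by
    refine lt_of_le_of_ne (by linarith) fun h => ?_
    have := key F₀ hF₀ 0 0 (J F₀ - 1) h₁ h₂ (by linarith)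
    rw [← h] at this
    simp at this
  refine ⟨-α' / γ, -β / γ, div_nonneg (by linarith) hγ.le, div_nonneg (by linarith) hγ.le,
    fun F hF => ?_⟩
  have h : g₁ F * α' + g₂ F * β + J F * γ ≤ C * γ := by
    have ht : Tendsto (fun ε : ℝ => (g₁ F + ε) * α' + (g₂ F + ε) * β + (J F - ε) * γ)
        (nhdsWithin 0 (Ioi 0)) (nhds ((g₁ F + 0) * α' + (g₂ F + 0) * β + (J F - 0) * γ)) :=
      (Continuous.tendsto (by fun_prop) 0).mono_left nhdsWithin_le_nhds
    simp only [add_zero, sub_zero] at ht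
    refine le_of_tendsto ht ?_
    filter_upwards [self_mem_nhdsWithin] with ε hε
    have hε : 0 < ε := hε
    exact (key F hF _ _ _ (by linarith) (by linarith) (by linarith)).le
  rw [← mul_le_mul_iff_left₀ hγ]
  calc _ = g₁ F * α' + g₂ F * β + J F * γ := by field_simp; ring
    _ ≤ _ := h

namespace IsDistOn

variable {A : ℝ} {F G : Measure ℝ}

lemma ae_mem (hF : IsDistOn A F) : ∀ᵐ x ∂F, x ∈ Icc 0 A := hF.2

lemma integrable_of_continuousOn (hF : IsDistOn A F) {f : ℝ → ℝ}
    (hf : ContinuousOn f (Icc 0 A)) : Integrable f F := by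
  have := hF.1
  have h : F.restrict (Icc 0 A) = F := Measure.restrict_eq_self_of_ae_mem hF.ae_mem
  have h2 : IntegrableOn f (Icc 0 A) F := hf.integrableOn_compact isCompact_Icc
  rwa [IntegrableOn, h] at h2

/-- Distributions on `[0, A]` are stable under mixtures. -/
lemma mix (hF : IsDistOn A F) (hG : IsDistOn A G) {a b : ℝ} (ha : 0 < a) (hb : 0 < b)
    (hab : a + b = 1) : IsDistOn A (ENNReal.ofReal a • F + ENNReal.ofReal b • G) := by
  have := hF.1
  have := hG.1
  refine ⟨⟨?_⟩, ?_⟩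
  · simp [← ENNReal.ofReal_add ha.le hb.le, hab]
  · simp [hF.2, hG.2]

end IsDistOn

lemma integral_mix {F G : Measure ℝ} {a b : ℝ} (ha : 0 < a) (hb : 0 < b) {f : ℝ → ℝ}
    (hF : Integrable f F) (hG : Integrable f G) :
    ∫ x, f x ∂(ENNReal.ofReal a • F + ENNReal.ofReal b • G)
      = a * ∫ x, f x ∂F + b * ∫ x, f x ∂G := by
  rw [integral_add_measure (hF.smul_measure ENNReal.ofReal_ne_top)
    (hG.smul_measure ENNReal.ofReal_ne_top), integral_smul_measure, integral_smul_measure,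
    ENNReal.toReal_ofReal ha.le, ENNReal.toReal_ofReal hb.le, smul_eq_mul, smul_eq_mul]

lemma continuous_besselI0 : Continuous besselI0 := by
  rw [continuous_iff_continuousAt]
  intro t
  have hs : ContinuousOn besselI0 (Metric.ball 0 (|t| + 1)) := by
    refine continuousOn_tsum (u := fun n : ℕ => ((|t| + 1) ^ 2 / 4) ^ n / (n.factorial : ℝ))
      (fun n => by fun_prop) (Real.summable_pow_div_factorial _) ?_
    intro n x hx
    have hx' : |x| ≤ |t| + 1 := by simpa using (Metric.mem_ball.1 hx).le
    have hn : (1 : ℝ) ≤ (n.factorial : ℝ) := by exact_mod_cast n.factorial_pos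
    have h0 : x ^ 2 ≤ (|t| + 1) ^ 2 := sq_le_sq' (by linarith [neg_abs_le x])
      ((le_abs_self x).trans hx')
    rw [Real.norm_of_nonneg (by positivity)]
    gcongr
    nlinarith
  exact hs.continuousAt (Metric.isOpen_ball.mem_nhds (by simp))

lemma continuous_EH (B h2 : ℝ) : Continuous (EH B h2) :=
  continuous_besselI0.comp (by fun_prop)

lemma pcond_pos (x y : ℝ) : 0 < pcond x y := by
  unfold pcond
  positivity

lemma continuous_pcond : Continuous fun p : ℝ × ℝ => pcond p.1 p.2 := by
  unfold pcond
  have : ∀ p : ℝ × ℝ, 1 + p.1 ^ 2 ≠ 0 := fun p => by positivity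
  fun_prop (disch := assumption)

section bounds

variable {A x y : ℝ}

lemma pcond_le_exp (hx : x ∈ Icc 0 A) (hy : 0 ≤ y) :
    pcond x y ≤ Real.exp (-y / (1 + A ^ 2)) := by
  have h : x ^ 2 ≤ A ^ 2 := pow_le_pow_left₀ hx.1 hx.2 2
  have h1 : 1 / (1 + x ^ 2) ≤ 1 := by
    rw [div_le_one (by positivity)]
    nlinarith
  have h2 : -y / (1 + x ^ 2) ≤ -y / (1 + A ^ 2) := by
    rw [neg_div, neg_div, neg_le_neg_iff]
    gcongr
  calc pcond x y ≤ 1 * Real.exp (-y / (1 + A ^ 2)) := by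
        unfold pcond
        gcongr
    _ = _ := one_mul _

lemma pcond_le_one (hy : 0 ≤ y) : pcond x y ≤ 1 := by
  refine (pcond_le_exp (A := |x|) (x := |x|) ⟨abs_nonneg x, le_rfl⟩ hy).trans' ?_ |>.trans ?_
  · simp [pcond]
  · rw [Real.exp_le_one_iff]
    exact div_nonpos_of_nonpos_of_nonneg (by linarith) (by positivity)

lemma le_pcond (hx : x ∈ Icc 0 A) (hy : 0 ≤ y) :
    1 / (1 + A ^ 2) * Real.exp (-y) ≤ pcond x y := by
  have h : x ^ 2 ≤ A ^ 2 := pow_le_pow_left₀ hx.1 hx.2 2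
  have h2 : -y ≤ -y / (1 + x ^ 2) := by
    rw [neg_div, neg_le_neg_iff]
    exact div_le_self hy (by nlinarith [sq_nonneg x])
  unfold pcond
  gcongr

lemma abs_log_le {p : ℝ} (hl : 1 / (1 + A ^ 2) * Real.exp (-y) ≤ p) (hu : p ≤ 1) :
    |Real.log p| ≤ Real.log (1 + A ^ 2) + y := by
  have hp : 0 < p := hl.trans_lt' (by positivity)
  have h1 := Real.log_le_log (by positivity) hl
  rw [Real.log_mul (by positivity) (by positivity), Real.log_exp, one_div, Real.log_inv] at h1
  rw [abs_of_nonpos (Real.log_nonpos hp.le hu)]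
  linarith

end bounds

section output

variable {A : ℝ} {F G : Measure ℝ}

lemma IsDistOn.integrable_pcond (hF : IsDistOn A F) (y : ℝ) :
    Integrable (fun x => pcond x y) F :=
  hF.integrable_of_continuousOn
    (continuous_pcond.comp (Continuous.prodMk_left y)).continuousOn

lemma IsDistOn.pout_le_exp (hF : IsDistOn A F) {y : ℝ} (hy : 0 ≤ y) :
    pout F y ≤ Real.exp (-y / (1 + A ^ 2)) := by
  have := hF.1
  calc pout F y ≤ ∫ _, Real.exp (-y / (1 + A ^ 2)) ∂F :=
        integral_mono_ae (hF.integrable_pcond y) (integrable_const _)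
          (hF.ae_mem.mono fun x hx => pcond_le_exp hx hy)
    _ = _ := by simp

lemma IsDistOn.pout_le_one (hF : IsDistOn A F) {y : ℝ} (hy : 0 ≤ y) : pout F y ≤ 1 := by
  have := hF.1
  calc pout F y ≤ ∫ _, 1 ∂F :=
        integral_mono_ae (hF.integrable_pcond y) (integrable_const _)
          (ae_of_all _ fun x => pcond_le_one hy)
    _ = _ := by simp

lemma IsDistOn.le_pout (hF : IsDistOn A F) {y : ℝ} (hy : 0 ≤ y) :
    1 / (1 + A ^ 2) * Real.exp (-y) ≤ pout F y := by
  have := hF.1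
  calc 1 / (1 + A ^ 2) * Real.exp (-y) = ∫ _, 1 / (1 + A ^ 2) * Real.exp (-y) ∂F := by simp
    _ ≤ _ := integral_mono_ae (integrable_const _) (hF.integrable_pcond y)
          (hF.ae_mem.mono fun x hx => le_pcond hx hy)

lemma IsDistOn.pout_pos (hF : IsDistOn A F) {y : ℝ} (hy : 0 ≤ y) : 0 < pout F y :=
  (hF.le_pout hy).trans_lt' (by positivity)

lemma IsDistOn.measurable_pout (hF : IsDistOn A F) : Measurable (pout F) := by
  have := hF.1
  exact (continuous_pcond.stronglyMeasurable.integral_prod_left (μ := F)).measurable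

/-- Integrability on `[0, A] × (0, ∞)` of a function dominated by a linear function of `y` times
the channel density. -/
lemma IsDistOn.integrable_pcond_mul (hF : IsDistOn A F) {g : ℝ × ℝ → ℝ} (hg : Measurable g)
    {c d : ℝ} (hb : ∀ x ∈ Icc 0 A, ∀ y > 0, |g (x, y)| ≤ c + d * y) :
    Integrable (fun p : ℝ × ℝ => pcond p.1 p.2 * g p)
      (F.prod (volume.restrict (Ioi (0 : ℝ)))) := by
  have := hF.1
  have hk : 0 < 1 / (1 + A ^ 2) := by positivity
  have h_int : Integrable (fun y : ℝ => Real.exp (-y / (1 + A ^ 2)) * (c + d * y))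
      (volume.restrict (Ioi (0 : ℝ))) := by
    have h1 : IntegrableOn (fun y : ℝ => Real.exp (-(1 / (1 + A ^ 2)) * y)) (Ioi 0) :=
      exp_neg_integrableOn_Ioi 0 hk
    have h2 : IntegrableOn (fun y : ℝ => y ^ (1 : ℝ) * Real.exp (-(1 / (1 + A ^ 2)) * y))
        (Ioi 0) :=
      (integrableOn_rpow_mul_exp_neg_mul_rpow (s := 1) (p := 1) (by norm_num) one_pos hk).congr_fun
        (fun y _ => by simp) measurableSet_Ioi
    refine ((Integrable.const_mul h1 c).add (Integrable.const_mul h2 d)).congr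
      (ae_of_all _ fun y => ?_)
    have : -(1 / (1 + A ^ 2)) * y = -y / (1 + A ^ 2) := by ring
    simp only [Pi.add_apply, Real.rpow_one, this]
    ring
  refine (h_int.comp_snd F).mono'
    (continuous_pcond.measurable.mul hg).aestronglyMeasurable ?_
  have h1 : ∀ᵐ p ∂(F.prod (volume.restrict (Ioi (0 : ℝ)))), p.1 ∈ Icc 0 A :=
    Measure.quasiMeasurePreserving_fst.ae hF.ae_mem
  have h2 : ∀ᵐ p ∂(F.prod (volume.restrict (Ioi (0 : ℝ)))), p.2 ∈ Ioi (0 : ℝ) :=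
    Measure.quasiMeasurePreserving_snd.ae (ae_restrict_mem measurableSet_Ioi)
  filter_upwards [h1, h2] with p hp1 hp2
  have hp2 : 0 < p.2 := hp2
  rw [norm_mul, Real.norm_of_nonneg (pcond_pos _ _).le, Real.norm_eq_abs]
  exact mul_le_mul (pcond_le_exp hp1 hp2.le) (hb _ hp1 _ hp2) (abs_nonneg _) (by positivity)

lemma IsDistOn.integrable_pcond_mul_log (hF : IsDistOn A F) (hG : IsDistOn A G) :
    Integrable (fun p : ℝ × ℝ => pcond p.1 p.2 * Real.log (pcond p.1 p.2 / pout G p.2))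
      (F.prod (volume.restrict (Ioi (0 : ℝ)))) := by
  refine hF.integrable_pcond_mul (g := fun p => Real.log (pcond p.1 p.2 / pout G p.2))
    (Real.measurable_log.comp
      (continuous_pcond.measurable.div (hG.measurable_pout.comp measurable_snd)))
    (c := 2 * Real.log (1 + A ^ 2)) (d := 2) ?_
  intro x hx y hy
  have hy : 0 < y := hy
  have e1 := abs_log_le (le_pcond hx hy.le) (pcond_le_one hy.le)
  have e2 := abs_log_le (hG.le_pout hy.le) (hG.pout_le_one hy.le)
  rw [Real.log_div (pcond_pos _ _).ne' (hG.pout_pos hy.le).ne']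
  have := abs_sub (Real.log (pcond x y)) (Real.log (pout G y))
  linarith

lemma IsDistOn.integrable_idens (hF : IsDistOn A F) (hG : IsDistOn A G) :
    Integrable (idens G) F :=
  have := hF.1
  (hF.integrable_pcond_mul_log hG).integral_prod_left

lemma integral_pcond (x : ℝ) : ∫ y in Ioi (0 : ℝ), pcond x y = 1 := by
  have hx : -(1 / (1 + x ^ 2)) < 0 := neg_lt_zero.2 (by positivity)
  have : ∀ y, pcond x y = 1 / (1 + x ^ 2) * Real.exp (-(1 / (1 + x ^ 2)) * y) := fun y => by
    unfold pcond
    ring_nf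
  simp only [this]
  rw [integral_const_mul, integral_exp_mul_Ioi hx]
  have : 1 + x ^ 2 ≠ 0 := by positivity
  field_simp
  simp

lemma IsDistOn.integrable_pcond_prod (hF : IsDistOn A F) :
    Integrable (fun p : ℝ × ℝ => pcond p.1 p.2) (F.prod (volume.restrict (Ioi (0 : ℝ)))) := by
  simpa using hF.integrable_pcond_mul (g := fun _ => 1) measurable_const (c := 1) (d := 0)
    (by simp)

lemma IsDistOn.integrable_pout (hF : IsDistOn A F) :
    Integrable (pout F) (volume.restrict (Ioi (0 : ℝ))) :=
  have := hF.1
  hF.integrable_pcond_prod.integral_prod_right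

lemma IsDistOn.integral_pout (hF : IsDistOn A F) : ∫ y in Ioi (0 : ℝ), pout F y = 1 := by
  have := hF.1
  unfold pout
  rw [← integral_integral_swap (f := fun x y => pcond x y) hF.integrable_pcond_prod]
  simp [integral_pcond]

/-- Gibbs' inequality: averaging the information density built from a mismatched output law
overestimates the mutual information. -/
lemma IsDistOn.MI_le (hF : IsDistOn A F) (hG : IsDistOn A G) :
    MI F ≤ ∫ x, idens G x ∂F := by
  have := hF.1
  have hi := (hF.integrable_pcond_mul_log hG).sub' (hF.integrable_pcond_mul_log hF)
  have hy_eq : ∀ y ∈ Ioi (0 : ℝ),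
      ∫ x, (pcond x y * Real.log (pcond x y / pout G y) -
        pcond x y * Real.log (pcond x y / pout F y)) ∂F =
      pout F y * Real.log (pout F y / pout G y) := by
    intro y hy
    have hy : 0 ≤ y := le_of_lt hy
    calc _ = ∫ x, pcond x y * Real.log (pout F y / pout G y) ∂F := by
          refine integral_congr_ae (ae_of_all _ fun x => ?_)
          have h1 := (pcond_pos x y).ne'
          have h2 := (hF.pout_pos hy).ne'
          have h3 := (hG.pout_pos hy).ne'
          dsimp only
          rw [Real.log_div h1 h2, Real.log_div h1 h3, Real.log_div h2 h3]
          ring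
      _ = _ := integral_mul_const _ _
  have key : ∫ x, idens G x ∂F - MI F =
      ∫ y in Ioi (0 : ℝ), pout F y * Real.log (pout F y / pout G y) := by
    unfold MI idens
    rw [← integral_prod _ (hF.integrable_pcond_mul_log hG),
      ← integral_prod _ (hF.integrable_pcond_mul_log hF),
      ← integral_sub (hF.integrable_pcond_mul_log hG) (hF.integrable_pcond_mul_log hF),
      integral_prod_symm _ hi]
    exact setIntegral_congr_fun measurableSet_Ioi hy_eq
  have h_int : Integrable (fun y => pout F y * Real.log (pout F y / pout G y))
      (volume.restrict (Ioi (0 : ℝ))) :=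
    hi.integral_prod_right.congr ((ae_restrict_mem measurableSet_Ioi).mono hy_eq)
  have hle : ∫ y in Ioi (0 : ℝ), (pout F y - pout G y) ≤
      ∫ y in Ioi (0 : ℝ), pout F y * Real.log (pout F y / pout G y) := by
    refine setIntegral_mono_on (hF.integrable_pout.sub hG.integrable_pout) h_int
      measurableSet_Ioi fun y hy => ?_
    have hy : 0 ≤ y := le_of_lt hy
    have hf := hF.pout_pos hy
    have hg := hG.pout_pos hy
    have h := mul_le_mul_of_nonneg_left
      (Real.one_sub_inv_le_log_of_pos (div_pos hf hg)) hf.le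
    calc pout F y - pout G y = pout F y * (1 - (pout F y / pout G y)⁻¹) := by field_simp
      _ ≤ _ := h
  rw [integral_sub hF.integrable_pout hG.integrable_pout, hF.integral_pout, hG.integral_pout,
    ← key] at hle
  linarith

/-- Mutual information is concave in the input distribution. -/
lemma IsDistOn.le_MI_mix (hF : IsDistOn A F) (hG : IsDistOn A G) {a b : ℝ} (ha : 0 < a)
    (hb : 0 < b) (hab : a + b = 1) :
    a * MI F + b * MI G ≤ MI (ENNReal.ofReal a • F + ENNReal.ofReal b • G) := by
  have hH := hF.mix hG ha hb hab
  rw [MI.eq_def (ENNReal.ofReal a • F + ENNReal.ofReal b • G),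
    integral_mix ha hb (hF.integrable_idens hH) (hG.integrable_idens hH)]
  exact add_le_add (mul_le_mul_of_nonneg_left (hF.MI_le hH) ha.le)
    (mul_le_mul_of_nonneg_left (hG.MI_le hH) hb.le)

end output

/-- Strong duality: if there is a Slater point `x₁ ∈ [0,A]` with
`x₁² < P` and `ℰ(x₁) > E_req` (and `C` is finite, i.e. the values `I(F)`, `F ∈ Ω`, are
bounded above), then there exist `λ₁, λ₂ ≥ 0` with
`C = sup_F I(F) − λ₁(∫x²dF − P) − λ₂(E_req − ∫ℰ dF)`, the sup over all Borel
probability measures on `[0, A]`. -/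
theorem stmt1 (A P B h2 Ereq : ℝ) (hA : 0 < A) (hP : 0 < P) (hB : 0 < B) (hh2 : 0 < h2)
    (hslater : ∃ x₁ ∈ Set.Icc (0 : ℝ) A, x₁ ^ 2 < P ∧ Ereq < EH B h2 x₁)
    (hfin : BddAbove (MI '' {F | Feas A P B h2 Ereq F})) :
    ∃ l1 l2 : ℝ, 0 ≤ l1 ∧ 0 ≤ l2 ∧
      Cap A P B h2 Ereq =
        sSup ((fun F : Measure ℝ =>
            MI F - l1 * ((∫ x, x ^ 2 ∂F) - P) - l2 * (Ereq - ∫ x, EH B h2 x ∂F)) ''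
          {F | IsDistOn A F}) := by
  obtain ⟨x₁, hx₁, hxP, hxE⟩ := hslater
  have hdirac : IsDistOn A (Measure.dirac x₁) :=
    ⟨inferInstance, by simp [Measure.dirac_apply' _ measurableSet_Icc.compl, hx₁]⟩
  have hsq : ∀ F, IsDistOn A F → Integrable (fun x : ℝ => x ^ 2) F := fun F hF =>
    hF.integrable_of_continuousOn (by fun_prop)
  have hEH : ∀ F, IsDistOn A F → Integrable (fun x => EH B h2 x) F := fun F hF =>
    hF.integrable_of_continuousOn (continuous_EH B h2).continuousOn
  obtain ⟨l1, l2, hl1, hl2, hL⟩ := exists_lagrange_multipliers (S := {F | IsDistOn A F})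
    (J := MI) (g₁ := fun F => (∫ x, x ^ 2 ∂F) - P) (g₂ := fun F => Ereq - ∫ x, EH B h2 x ∂F)
    (C := Cap A P B h2 Ereq) (F₀ := Measure.dirac x₁)
    (by
      intro F hF G hG a b ha hb hab
      refine ⟨_, IsDistOn.mix hF hG ha hb hab, ?_, ?_, IsDistOn.le_MI_mix hF hG ha hb hab⟩
      · rw [integral_mix ha hb (hsq F hF) (hsq G hG)]
        obtain rfl : b = 1 - a := by linarith
        apply le_of_eq
        ring
      · rw [integral_mix ha hb (hEH F hF) (hEH G hG)]
        obtain rfl : b = 1 - a := by linarith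
        apply le_of_eq
        ring)
    hdirac (by simpa using hxP) (by simpa using hxE)
    (fun F hF h₁ h₂ => le_csSup hfin ⟨F, ⟨hF, sub_nonpos.1 h₁, sub_nonpos.1 h₂⟩, rfl⟩)
  refine ⟨l1, l2, hl1, hl2, le_antisymm ?_ ?_⟩
  · refine csSup_le ⟨_, Measure.dirac x₁, ⟨hdirac, by simpa using hxP.le,
      by simpa using hxE.le⟩, rfl⟩ ?_
    rintro _ ⟨F, ⟨hF, h₁, h₂⟩, rfl⟩
    refine le_csSup_of_le ⟨Cap A P B h2 Ereq, ?_⟩ ⟨F, hF, rfl⟩ ?_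
    · rintro _ ⟨G, hG, rfl⟩
      exact hL G hG
    · have e₁ := mul_nonneg hl1 (sub_nonneg.2 h₁)
      have e₂ := mul_nonneg hl2 (sub_nonneg.2 h₂)
      dsimp only
      linarith
  · refine csSup_le ⟨_, Measure.dirac x₁, hdirac, rfl⟩ ?_
    rintro _ ⟨F, hF, rfl⟩
    exact hL F hF
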